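/- Let X be a finite uniform d-dimensional simplicial complex with d ≥ 2, and let p satisfy (d−1)/(3d−1) < p < 1. Then the dimension of H_{d−1}(X;ℝ) equals the dimension of the linear span of the set {P_{Z_{d−1}}(Ẽ_∞^σ) : σ an oriented (d−1)-cell of X}, where Ẽ_∞^σ = lim_{n→∞} Ẽ_n^σ (which exists) and P_{Z_{d−1}} is the orthogonal projection of Ω^{d−1} onto Z_{d−1} = ker ∂_{d−1}. -/

import Mathlib

open scoped BigOperators Classical
open Filter Topology

noncomputable section

/-- A simplicial complex on a vertex set `V`: a family of finite subsets of `V`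
(the cells) closed under taking nonempty subsets. -/
structure SComplex (V : Type*) where
  cells : Set (Finset V)
  down_closed : ∀ ⦃s t : Finset V⦄, s ∈ cells → t ⊆ s → t.Nonempty → t ∈ cells

namespace SComplex

variable {V : Type*} (X : SComplex V)

/-- The tuple `σ` of `n` vertices spans an `(n-1)`-dimensional cell of `X`. -/
def IsCellT {n : ℕ} (σ : Fin n → V) : Prop :=
  Function.Injective σ ∧ Finset.image σ Finset.univ ∈ X.cells

/-- The degree of a cell `s`: the number of cells with one more vertex containing it. -/
def degS (s : Finset V) : ℕ :=
  Set.ncard {t : Finset V | t ∈ X.cells ∧ t.card = s.card + 1 ∧ s ⊆ t}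

/-- Degree of the cell spanned by a tuple. -/
def degT {n : ℕ} (σ : Fin n → V) : ℕ :=
  X.degS (Finset.image σ Finset.univ)

/-- An `(n-1)`-form: an alternating function on oriented `(n-1)`-cells, encoded as a
function on `n`-tuples of vertices which vanishes off the cells of `X` and is
antisymmetric under permutations. -/
def IsForm (n : ℕ) (f : (Fin n → V) → ℝ) : Prop :=
  (∀ σ, ¬ X.IsCellT σ → f σ = 0) ∧
  ∀ (σ : Fin n → V) (π : Equiv.Perm (Fin n)),
    f (σ ∘ π) = ((Equiv.Perm.sign π : ℤ) : ℝ) * f σ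

/-- The Dirac form `𝟙_{σ₀}`: 1 at `σ₀`, -1 at the reversed orientation, 0 elsewhere. -/
def dirac {n : ℕ} (σ₀ : Fin n → V) : (Fin n → V) → ℝ := fun σ =>
  if ∃ π : Equiv.Perm (Fin n), Equiv.Perm.sign π = 1 ∧ σ = σ₀ ∘ π then 1
  else if ∃ π : Equiv.Perm (Fin n), Equiv.Perm.sign π = -1 ∧ σ = σ₀ ∘ π then -1
  else 0

/-- The boundary operator: `(∂f)(σ) = Σ_{v : vσ ∈ X} f(vσ)`. -/
def bdry {n : ℕ} (f : (Fin (n + 1) → V) → ℝ) : (Fin n → V) → ℝ := fun σ =>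
  ∑ᶠ v ∈ {v : V | X.IsCellT (Fin.cons v σ)}, f (Fin.cons v σ)

/-- The weighted sum of `f` over the neighbours of `σ`:
`Σ_{σ' ∼ σ} f(σ')/deg σ' = Σ_{v ◁ σ} Σ_i (-1)^i f(v(σ∖σ_i))/deg(v(σ∖σ_i))`. -/
def nbrW {n : ℕ} (f : (Fin (n + 1) → V) → ℝ) : (Fin (n + 1) → V) → ℝ := fun σ =>
  ∑ᶠ v ∈ {v : V | X.IsCellT (Fin.cons v σ)},
    ∑ i : Fin (n + 1),
      (-1 : ℝ) ^ (i : ℕ) * f (Fin.cons v (σ ∘ i.succAbove)) /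
        (X.degT (Fin.cons v (σ ∘ i.succAbove)) : ℝ)

/-- The unweighted sum of `f` over the neighbours of `σ`: `Σ_{σ' ∼ σ} f(σ')`. -/
def nbrU {n : ℕ} (f : (Fin (n + 1) → V) → ℝ) : (Fin (n + 1) → V) → ℝ := fun σ =>
  ∑ᶠ v ∈ {v : V | X.IsCellT (Fin.cons v σ)},
    ∑ i : Fin (n + 1), (-1 : ℝ) ^ (i : ℕ) * f (Fin.cons v (σ ∘ i.succAbove))

/-- The upper Laplacian `(Δ⁺f)(σ) = f(σ) - Σ_{σ'∼σ} f(σ')/deg σ'`. -/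
def lapUp {n : ℕ} (f : (Fin (n + 1) → V) → ℝ) : (Fin (n + 1) → V) → ℝ := fun σ =>
  f σ - X.nbrW f σ

/-- The transition operator of the `p`-lazy walk:
`(Af)(σ) = p f(σ) + ((1-p)/d) Σ_{σ'∼σ} f(σ')/deg σ'`, where `d = n+1`. -/
def transOp {n : ℕ} (p : ℝ) (f : (Fin (n + 1) → V) → ℝ) : (Fin (n + 1) → V) → ℝ := fun σ =>
  p * f σ + ((1 - p) / ((n : ℝ) + 1)) * X.nbrW f σ

/-- The normalized expectation process `Ẽ_nn = (d/(p(d-1)+1))^nn • A^nn 𝟙_{σ₀}`. -/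
def nexp {n : ℕ} (p : ℝ) (σ₀ : Fin (n + 1) → V) (nn : ℕ) : (Fin (n + 1) → V) → ℝ :=
  (((n : ℝ) + 1) / (p * (n : ℝ) + 1)) ^ nn • (X.transOp p)^[nn] (SComplex.dirac σ₀)

/-- The weighted inner product `⟨f,g⟩ = Σ_{σ ∈ X^{n-1}} f(σ)g(σ)/deg σ`
(each unoriented cell is represented by `n!` tuples). -/
def innerW [Fintype V] {n : ℕ} (f g : (Fin n → V) → ℝ) : ℝ :=
  (1 / (n.factorial : ℝ)) * ∑ σ : Fin n → V, f σ * g σ / (X.degT σ : ℝ)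

/-- The unweighted inner product `⟨f,g⟩ = Σ_{σ ∈ X^{n-1}} f(σ)g(σ)`. -/
def innerU [Fintype V] {n : ℕ} (f g : (Fin n → V) → ℝ) : ℝ :=
  (1 / (n.factorial : ℝ)) * ∑ σ : Fin n → V, f σ * g σ

/-- The norm induced by the weighted inner product. -/
def normW [Fintype V] {n : ℕ} (f : (Fin n → V) → ℝ) : ℝ :=
  Real.sqrt (X.innerW f f)

/-- `f` is a closed `(d-1)`-form (`f ∈ Z^{d-1} = ker ∂_d^*`), characterized by
orthogonality to the image of `∂_d`. -/
def IsClosedForm [Fintype V] (m : ℕ) (f : (Fin (m + 2) → V) → ℝ) : Prop :=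
  X.IsForm (m + 2) f ∧
  ∀ g : (Fin (m + 3) → V) → ℝ, X.IsForm (m + 3) g → X.innerW f (X.bdry g) = 0

/-- `f` is an exact `(d-1)`-form (`f ∈ B^{d-1} = im ∂_{d-1}^*`): `f = ∂_{d-1}^* g` for a
`(d-2)`-form `g`, characterized by the adjoint identity. -/
def IsExactForm [Fintype V] (m : ℕ) (f : (Fin (m + 2) → V) → ℝ) : Prop :=
  X.IsForm (m + 2) f ∧
  ∃ g : (Fin (m + 1) → V) → ℝ, X.IsForm (m + 1) g ∧
    ∀ h : (Fin (m + 2) → V) → ℝ, X.IsForm (m + 2) h →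
      X.innerW f h = innerU g (X.bdry h)

/-- Two tuples span the same oriented cell. -/
def SameOr {n : ℕ} (σ σ' : Fin n → V) : Prop :=
  ∃ π : Equiv.Perm (Fin n), Equiv.Perm.sign π = 1 ∧ σ' = σ ∘ π

/-- The neighbour relation on oriented `(d-1)`-cells: `σ ∼ σ'` iff there is an oriented
`d`-cell of which both `σ` and the reversal of `σ'` are faces with the induced
orientation; equivalently `σ' = (-1)^i v(σ∖σ_i)` for some `v ◁ σ`. -/
def Nbr {n : ℕ} (σ σ' : Fin (n + 1) → V) : Prop :=
  ∃ (v : V) (i : Fin (n + 1)), X.IsCellT (Fin.cons v σ) ∧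
    (if Even (i : ℕ) then SameOr σ' (Fin.cons v (σ ∘ i.succAbove))
     else SameOr σ' (Fin.cons v (σ ∘ i.succAbove) ∘ Equiv.swap 0 1))

/-- `σ` is a face of the oriented cell `τ` with the orientation induced by `τ`. -/
def IsInducedFace {n : ℕ} (σ : Fin (n + 1) → V) (τ : Fin (n + 2) → V) : Prop :=
  ∃ i : Fin (n + 2), if Even (i : ℕ) then SameOr σ (τ ∘ i.succAbove)
    else SameOr σ (τ ∘ i.succAbove ∘ Equiv.swap 0 1)

/-- The family `𝒯` of `d`-cells (`d = m+2`) admits a disorientation: a choice of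
orientation for each cell of `𝒯` such that any two of them sharing a
codimension-one face induce the same orientation on it. -/
def HasDisorientation (m : ℕ) (𝒯 : Set (Finset V)) : Prop :=
  ∃ c : Finset V → (Fin (m + 3) → V),
    (∀ t ∈ 𝒯, Function.Injective (c t) ∧ Finset.image (c t) Finset.univ = t) ∧
    ∀ t ∈ 𝒯, ∀ t' ∈ 𝒯, t ≠ t' → (t ∩ t').card = m + 2 →
      ∃ σ : Fin (m + 2) → V, Function.Injective σ ∧
        Finset.image σ Finset.univ = t ∩ t' ∧
        IsInducedFace σ (c t) ∧ IsInducedFace σ (c t')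

/-- `X` (of dimension `d`) has no simple `d`-loops: no non-backtracking closed chain
of `d`-cells in which consecutive cells share a `(d-1)`-cell. -/
def NoSimpleLoops (d : ℕ) : Prop :=
  ∀ (n : ℕ) (τ : ℕ → Finset V), 2 ≤ n → (∀ i, τ (i + n) = τ i) →
    (∀ i, τ i ∈ X.cells ∧ (τ i).card = d + 1) →
    (∀ i, (τ i ∩ τ (i + 1)) ∈ X.cells ∧ (τ i ∩ τ (i + 1)).card = d) →
    (∀ i, τ i ≠ τ (i + 2)) → False

end SComplex

open SComplex

namespace SComplex

variable {V : Type*} (X : SComplex V)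

/-- The subspace of `(n-1)`-forms inside all functions on `n`-tuples of vertices. -/
def formSubmodule (n : ℕ) : Submodule ℝ ((Fin n → V) → ℝ) where
  carrier := {f | X.IsForm n f}
  add_mem' := by
    rintro f g ⟨hf0, hfa⟩ ⟨hg0, hga⟩
    refine ⟨fun σ h => ?_, fun σ π => ?_⟩
    · simp [Pi.add_apply, hf0 σ h, hg0 σ h]
    · simp only [Pi.add_apply, hfa σ π, hga σ π]; ring
  zero_mem' := ⟨fun _ _ => rfl, fun _ _ => by simp⟩
  smul_mem' := by
    rintro c f ⟨hf0, hfa⟩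
    refine ⟨fun σ h => ?_, fun σ π => ?_⟩
    · simp [hf0 σ h]
    · simp only [Pi.smul_apply, smul_eq_mul, hfa σ π]; ring

/-- The boundary operator as a linear map:
`(∂f)(σ) = Σ_{v : vσ ∈ X} f(vσ)`. -/
def bdryHom [Fintype V] (n : ℕ) :
    ((Fin (n + 1) → V) → ℝ) →ₗ[ℝ] ((Fin n → V) → ℝ) where
  toFun f := fun σ =>
    ∑ v ∈ Finset.univ.filter (fun v => X.IsCellT (Fin.cons v σ)), f (Fin.cons v σ)
  map_add' f g := by
    funext σ
    simp [Finset.sum_add_distrib]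
  map_smul' c f := by
    funext σ
    simp [Finset.mul_sum]

end SComplex

section Abstract

variable {W : Type*} [AddCommGroup W] [Module ℝ W] [FiniteDimensional ℝ W]

/-- The spectral theorem for an operator that is symmetric with respect to a positive definite
symmetric bilinear form. -/
theorem exists_eigenbasis_of_symm (B : LinearMap.BilinForm ℝ W)
    (hs : ∀ x y, B x y = B y x) (hp : ∀ x, x ≠ 0 → 0 < B x x) (T : W →ₗ[ℝ] W)
    (hT : ∀ x y, B (T x) y = B x (T y)) :
    ∃ (b : Module.Basis (Fin (Module.finrank ℝ W)) ℝ W) (μ : Fin (Module.finrank ℝ W) → ℝ),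
      ∀ i, T (b i) = μ i • b i := by
  let core : InnerProductSpace.Core ℝ W :=
    { inner := fun x y => B x y
      conj_inner_symm := fun x y => by simpa using hs y x
      re_inner_nonneg := fun x => by
        by_cases h : x = 0
        · simp [h]
        · simpa using (hp x h).le
      add_left := fun x y z => by simp
      smul_left := fun x y r => by simp
      definite := fun x hx => by
        by_contra h
        exact (hp x h).ne' hx }
  let : NormedAddCommGroup W := core.toNormedAddCommGroup
  let : InnerProductSpace ℝ W := InnerProductSpace.ofCore core.toCore
  have hsym : T.IsSymmetric := fun x y => hT x y
  exact ⟨(hsym.eigenvectorBasis rfl).toBasis, hsym.eigenvalues rfl, fun i => by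
    simp [hsym.apply_eigenvectorBasis rfl i]⟩

/-- If `0 ≤ T ≤ K` and `a K < 2`, the iterates of `1 - a T` converge to the orthogonal projection
onto `ker T`. -/
theorem exists_tendsto_iterate_one_sub {E : Type*} [AddCommGroup E] [Module ℝ E]
    [TopologicalSpace E] [ContinuousAdd E] [ContinuousSMul ℝ E]
    (ι : W →ₗ[ℝ] E) (B : LinearMap.BilinForm ℝ W)
    (hs : ∀ x y, B x y = B y x) (hp : ∀ x, x ≠ 0 → 0 < B x x) (T : W →ₗ[ℝ] W)
    (hT : ∀ x y, B (T x) y = B x (T y)) {K a : ℝ}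
    (h0 : ∀ x, 0 ≤ B (T x) x) (hK : ∀ x, B (T x) x ≤ K * B x x)
    (ha : 0 < a) (haK : a * K < 2) (f : W) :
    ∃ L : W, T L = 0 ∧ (∀ h, T h = 0 → B L h = B f h) ∧
      Tendsto (fun n : ℕ => ι (((1 - a • T) ^ n) f)) atTop (𝓝 (ι L)) := by
  obtain ⟨b, μ, hb⟩ := exists_eigenbasis_of_symm B hs hp T hT
  have hpos : ∀ i, 0 < B (b i) (b i) := fun i => hp _ (b.ne_zero i)
  have hμ0 : ∀ i, 0 ≤ μ i := fun i => by
    have := h0 (b i)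
    rw [hb] at this
    simpa using nonneg_of_mul_nonneg_left (by simpa using this) (hpos i)
  have hμK : ∀ i, μ i ≤ K := fun i => by
    have := hK (b i)
    rw [hb] at this
    exact le_of_mul_le_mul_right (by simpa using this) (hpos i)
  have hpow : ∀ (n : ℕ) i, ((1 - a • T) ^ n) (b i) = (1 - a * μ i) ^ n • b i := by
    intro n i
    induction n with
    | zero => simp
    | succ n ih =>
      rw [pow_succ', Module.End.mul_apply, ih, map_smul, pow_succ, mul_smul]
      congr 1
      simp [hb, sub_smul, mul_smul]
  refine ⟨∑ i, (if μ i = 0 then b.repr f i else 0) • b i, ?_, fun h hh => ?_, ?_⟩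
  · rw [map_sum]
    refine Finset.sum_eq_zero fun i _ => ?_
    split_ifs with h <;> simp [hb, h]
  · conv_rhs => rw [← b.sum_repr f]
    simp only [map_sum, LinearMap.sum_apply]
    refine Finset.sum_congr rfl fun i _ => ?_
    split_ifs with hi
    · rfl
    · have : μ i * B (b i) h = 0 := by
        have := hT (b i) h
        simpa [hb, hh] using this
      simp [(mul_eq_zero.1 this).resolve_left hi]
  · have hf : ∀ n : ℕ, ι (((1 - a • T) ^ n) f) =
        ∑ i, ((1 - a * μ i) ^ n * b.repr f i) • ι (b i) := fun n => by
      conv_lhs => rw [← b.sum_repr f]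
      simp only [map_sum, map_smul, hpow, smul_smul, mul_comm]
    simp only [hf, map_sum, map_smul]
    refine tendsto_finsetSum _ fun i _ => Tendsto.smul_const ?_ _
    split_ifs with hi
    · simp [hi]
    · have h1 : |1 - a * μ i| < 1 := by
        have h2 : 0 < a * μ i := mul_pos ha (lt_of_le_of_ne (hμ0 i) (Ne.symm hi))
        have h3 : a * μ i ≤ a * K := mul_le_mul_of_nonneg_left (hμK i) ha.le
        rw [abs_lt]
        constructor <;> linarith
      simpa using (tendsto_pow_atTop_nhds_zero_of_abs_lt_one h1).mul_const (b.repr f i)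

/-- Mutually orthogonal submodules `U, S` of `Z` with no nonzero common orthogonal vector in `Z`
have complementary dimensions in `Z`. -/
theorem finrank_add_finrank_of_orthogonal (B : LinearMap.BilinForm ℝ W)
    (hs : ∀ x y, B x y = B y x) {Z U S : Submodule ℝ W} (hU : U ≤ Z) (hS : S ≤ Z)
    (horth : ∀ x ∈ U, ∀ y ∈ S, B x y = 0)
    (hcompl : ∀ z ∈ Z, (∀ x ∈ U, B x z = 0) → (∀ y ∈ S, B y z = 0) → z = 0) :
    Module.finrank ℝ U + Module.finrank ℝ S = Module.finrank ℝ Z := by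
  have hinf : U ⊓ S = ⊥ := by
    rw [eq_bot_iff]
    rintro x ⟨hxU, hxS⟩
    exact hcompl x (hU hxU) (fun y hy => horth y hy x hxS)
      fun y hy => (hs y x).trans (horth x hxU y hy)
  have h1 := Submodule.finrank_sup_add_finrank_inf_eq U S
  rw [hinf, finrank_bot, add_zero] at h1
  rw [← h1]
  refine le_antisymm (Submodule.finrank_mono (sup_le hU hS)) ?_
  let φ : Z →ₗ[ℝ] Module.Dual ℝ ↥(U ⊔ S) := B.domRestrict₁₂ Z (U ⊔ S)
  have hφ : Function.Injective φ := by
    rw [← LinearMap.ker_eq_bot, LinearMap.ker_eq_bot']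
    intro z hz
    have key : ∀ y ∈ U ⊔ S, B y z = 0 := fun y hy =>
      (hs y z).trans (LinearMap.congr_fun hz (⟨y, hy⟩ : ↥(U ⊔ S)))
    exact Subtype.ext (hcompl z z.2 (fun y hy => key y (Submodule.mem_sup_left hy))
      fun y hy => key y (Submodule.mem_sup_right hy))
  simpa using LinearMap.finrank_le_finrank_of_injective hφ

end Abstract

namespace SComplex

variable {V : Type*} {X : SComplex V}

theorem image_comp_perm {n : ℕ} (σ : Fin n → V) (π : Equiv.Perm (Fin n)) :
    Finset.image (σ ∘ π) Finset.univ = Finset.image σ Finset.univ := by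
  rw [← Finset.image_image, Finset.image_univ_equiv]

theorem isCellT_comp_perm {n : ℕ} {σ : Fin n → V} (π : Equiv.Perm (Fin n)) :
    X.IsCellT (σ ∘ π) ↔ X.IsCellT σ := by
  rw [IsCellT, IsCellT, image_comp_perm, Equiv.injective_comp]

theorem degT_comp_perm {n : ℕ} (σ : Fin n → V) (π : Equiv.Perm (Fin n)) :
    X.degT (σ ∘ π) = X.degT σ := by
  rw [degT, degT, image_comp_perm]

theorem image_cons {n : ℕ} (v : V) (σ : Fin n → V) :
    Finset.image (Fin.cons v σ : Fin (n + 1) → V) Finset.univ =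
      insert v (Finset.image σ Finset.univ) := by
  ext w
  simp [Fin.exists_fin_succ, eq_comm]

theorem IsCellT.of_cons {n : ℕ} {v : V} {σ : Fin (n + 1) → V}
    (h : X.IsCellT (Fin.cons v σ : Fin (n + 2) → V)) : X.IsCellT σ := by
  refine ⟨(Fin.cons_injective_iff.1 h.1).2, X.down_closed h.2 ?_ ?_⟩
  · rw [image_cons]
    exact Finset.subset_insert _ _
  · simp

/-- The permutation of `Fin (n + 1)` fixing `0` and acting as `π` on the successors. -/
def succPerm {n : ℕ} (π : Equiv.Perm (Fin n)) : Equiv.Perm (Fin (n + 1)) :=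
  Equiv.Perm.decomposeFin.symm (0, π)

theorem sign_succPerm {n : ℕ} (π : Equiv.Perm (Fin n)) :
    Equiv.Perm.sign (succPerm π) = Equiv.Perm.sign π := by
  simp [succPerm, Equiv.Perm.decomposeFin.symm_sign]

theorem tail_comp_succPerm {n : ℕ} (τ : Fin (n + 1) → V) (π : Equiv.Perm (Fin n)) :
    (Fin.tail (τ ∘ succPerm π) : Fin n → V) = Fin.tail τ ∘ π := by
  funext j
  simp [Fin.tail, succPerm]

theorem cons_comp_succPerm {n : ℕ} (v : V) (σ : Fin n → V) (π : Equiv.Perm (Fin n)) :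
    (Fin.cons v σ : Fin (n + 1) → V) ∘ succPerm π = Fin.cons v (σ ∘ π) := by
  funext j
  refine Fin.cases ?_ (fun j => ?_) j <;> simp [succPerm]

theorem exists_eq_succPerm {n : ℕ} {π : Equiv.Perm (Fin (n + 1))} (h : π 0 = 0) :
    ∃ e, π = succPerm e := by
  obtain ⟨⟨q, e⟩, rfl⟩ := Equiv.Perm.decomposeFin.symm.surjective π
  obtain rfl : q = 0 := by simpa using h
  exact ⟨e, rfl⟩

theorem sign_mul_self {n : ℕ} (π : Equiv.Perm (Fin n)) :
    ((Equiv.Perm.sign π : ℤ) : ℝ) * ((Equiv.Perm.sign π : ℤ) : ℝ) = 1 := by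
  rw [← Int.cast_mul, ← Units.val_mul, Int.units_mul_self]
  simp

theorem sum_tuple_succ [Fintype V] {n : ℕ} (h : (Fin (n + 1) → V) → ℝ) :
    ∑ τ, h τ = ∑ σ : Fin n → V, ∑ v, h (Fin.cons v σ) := by
  rw [Finset.sum_comm, ← Fintype.sum_prod_type',
    ← (Fin.consEquiv fun _ : Fin (n + 1) => V).sum_comp]
  rfl

theorem sum_comp_perm [Fintype V] {n : ℕ} (π : Equiv.Perm (Fin n)) (h : (Fin n → V) → ℝ) :
    ∑ τ : Fin n → V, h (τ ∘ π) = ∑ τ, h τ :=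
  (Equiv.arrowCongr π.symm (Equiv.refl V)).sum_comp h

theorem bdryHom_apply_of_isForm [Fintype V] {n : ℕ} {g : (Fin (n + 1) → V) → ℝ}
    (hg : X.IsForm (n + 1) g) (σ : Fin n → V) :
    X.bdryHom n g σ = ∑ v, g (Fin.cons v σ) := by
  change ∑ v ∈ _, _ = _
  rw [Finset.sum_filter]
  refine Finset.sum_congr rfl fun v _ => ?_
  split_ifs with h
  · rfl
  · exact (hg.1 _ h).symm

theorem isForm_bdryHom [Fintype V] {n : ℕ} {g : (Fin (n + 2) → V) → ℝ}
    (hg : X.IsForm (n + 2) g) : X.IsForm (n + 1) (X.bdryHom (n + 1) g) := by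
  refine ⟨fun σ hσ => ?_, fun σ π => ?_⟩
  · rw [bdryHom_apply_of_isForm hg]
    exact Finset.sum_eq_zero fun v _ => hg.1 _ fun h => hσ h.of_cons
  · simp only [bdryHom_apply_of_isForm hg, Finset.mul_sum]
    refine Finset.sum_congr rfl fun v _ => ?_
    rw [← cons_comp_succPerm, hg.2, sign_succPerm]

theorem bdryHom_bdryHom [Fintype V] {n : ℕ} {g : (Fin (n + 2) → V) → ℝ}
    (hg : X.IsForm (n + 2) g) : X.bdryHom n (X.bdryHom (n + 1) g) = 0 := by
  funext σ
  have hswap : ∀ v w, g (Fin.cons w (Fin.cons v σ : Fin (n + 1) → V)) =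
      -g (Fin.cons v (Fin.cons w σ : Fin (n + 1) → V)) := fun v w => by
    have := hg.2 (Fin.cons v (Fin.cons w σ : Fin (n + 1) → V)) (Equiv.swap 0 1)
    rw [Equiv.Perm.sign_swap (by simp)] at this
    convert this using 1
    · congr 1
      funext j
      refine Fin.cases ?_ (fun j => ?_) j
      · simp
      · refine Fin.cases ?_ (fun j => ?_) j
        · simp
        · have hj : Equiv.swap (0 : Fin (n + 2)) 1 j.succ.succ = j.succ.succ :=
            Equiv.swap_apply_of_ne_of_ne (Fin.succ_ne_zero _)
              fun h => Fin.succ_ne_zero j (Fin.succ_injective _ h)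
          rw [Function.comp_apply, hj]
          simp
    · simp
  have h := bdryHom_apply_of_isForm (isForm_bdryHom hg) σ
  simp only [bdryHom_apply_of_isForm hg] at h
  have h2 : ∑ v, ∑ w, g (Fin.cons w (Fin.cons v σ : Fin (n + 1) → V)) =
      -∑ v, ∑ w, g (Fin.cons w (Fin.cons v σ : Fin (n + 1) → V)) := by
    conv_lhs => rw [Finset.sum_comm]
    simp only [← Finset.sum_neg_distrib, ← hswap]
  rw [h]
  change _ = (0 : ℝ)
  linarith

variable (X)

/-- The value of a form on the `i`-th face with its induced orientation, divided by the degree of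
the face. -/
def faceTerm {n : ℕ} (f : (Fin n → V) → ℝ) (τ : Fin (n + 1) → V) (i : Fin (n + 1)) : ℝ :=
  (-1) ^ (i : ℕ) * (f (τ ∘ i.succAbove) / X.degT (τ ∘ i.succAbove))

/-- The adjoint of `bdryHom` with respect to `innerW` on the faces and `innerU` on the cofaces. -/
def cobdHom (n : ℕ) : ((Fin n → V) → ℝ) →ₗ[ℝ] ((Fin (n + 1) → V) → ℝ) where
  toFun f τ := if X.IsCellT τ then ∑ i, X.faceTerm f τ i else 0
  map_add' f g := by
    funext τ
    by_cases h : X.IsCellT τ <;>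
      simp [h, faceTerm, ← Finset.sum_add_distrib, mul_add, add_div]
  map_smul' c f := by
    funext τ
    by_cases h : X.IsCellT τ
    · simp [h, faceTerm, Finset.mul_sum, mul_left_comm, mul_div_assoc]
    · simp [h]

variable {X}

theorem faceTerm_eq {n : ℕ} {f : (Fin n → V) → ℝ} (hf : X.IsForm n f) (τ : Fin (n + 1) → V)
    (π : Equiv.Perm (Fin (n + 1))) :
    X.faceTerm f τ (π 0) = ((Equiv.Perm.sign π : ℤ) : ℝ) *
      (f (Fin.tail (τ ∘ π)) / X.degT (Fin.tail (τ ∘ π))) := by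
  set i := π 0 with hi
  obtain ⟨e, he⟩ : ∃ e, i.cycleRange * π = succPerm e :=
    exists_eq_succPerm (by rw [Equiv.Perm.mul_apply, ← hi, Fin.cycleRange_self])
  have hπ : π = i.cycleRange.symm * succPerm e := by
    rw [← he, ← Equiv.Perm.inv_def, inv_mul_cancel_left]
  have hface : τ ∘ i.succAbove = Fin.tail (τ ∘ i.cycleRange.symm) := by
    funext j
    simp [Fin.tail]
  have htail : Fin.tail (τ ∘ π) = (τ ∘ i.succAbove) ∘ e := by
    rw [hface, ← tail_comp_succPerm, hπ]
    rfl
  have hsign : ((Equiv.Perm.sign π : ℤ) : ℝ) =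
      (-1) ^ (i : ℕ) * ((Equiv.Perm.sign e : ℤ) : ℝ) := by
    rw [hπ, Equiv.Perm.sign_mul, Equiv.Perm.sign_symm, Fin.sign_cycleRange, sign_succPerm]
    push_cast
    rfl
  rw [htail, hf.2, degT_comp_perm, hsign, faceTerm]
  linear_combination -((-1) ^ (i : ℕ) * (f (τ ∘ i.succAbove) / X.degT (τ ∘ i.succAbove))) *
    sign_mul_self e

theorem isForm_cobdHom {n : ℕ} {f : (Fin n → V) → ℝ} (hf : X.IsForm n f) :
    X.IsForm (n + 1) (X.cobdHom n f) := by
  refine ⟨fun τ hτ => if_neg hτ, fun τ ρ => ?_⟩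
  change (if _ then _ else _) = _ * (if _ then _ else _)
  rw [isCellT_comp_perm]
  split_ifs with h
  · rw [Finset.mul_sum,
      ← Equiv.sum_comp ρ fun i => ((Equiv.Perm.sign ρ : ℤ) : ℝ) * X.faceTerm f τ i]
    refine Finset.sum_congr rfl fun i _ => ?_
    have h1 := faceTerm_eq hf (τ ∘ ρ) i.cycleRange.symm
    have h2 := faceTerm_eq hf τ (ρ * i.cycleRange.symm)
    rw [Fin.cycleRange_symm_zero] at h1
    rw [Equiv.Perm.mul_apply, Fin.cycleRange_symm_zero, Equiv.Perm.sign_mul] at h2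
    rw [h1, h2]
    push_cast
    rw [← mul_assoc, ← mul_assoc, sign_mul_self, one_mul]
    rfl
  · simp

/-- By symmetry, a sum over all faces of all `(n + 1)`-tuples is `n + 1` times the sum over the
faces opposite to the first vertex. -/
theorem sum_faceTerm [Fintype V] {n : ℕ} {f : (Fin n → V) → ℝ} (hf : X.IsForm n f)
    {G : (Fin (n + 1) → V) → ℝ → ℝ}
    (hG : ∀ τ (π : Equiv.Perm (Fin (n + 1))) x,
      G (τ ∘ π) x = G τ (((Equiv.Perm.sign π : ℤ) : ℝ) * x)) :
    ∑ τ, ∑ i, G τ (X.faceTerm f τ i) =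
      (n + 1) * ∑ σ : Fin n → V, ∑ v, G (Fin.cons v σ) (f σ / X.degT σ) := by
  rw [Finset.sum_comm]
  have : ∀ i : Fin (n + 1), ∑ τ, G τ (X.faceTerm f τ i) =
      ∑ σ : Fin n → V, ∑ v, G (Fin.cons v σ) (f σ / X.degT σ) := fun i => by
    have h2 := sum_tuple_succ fun τ : Fin (n + 1) → V =>
      G τ (f (Fin.tail τ) / X.degT (Fin.tail τ))
    simp only [Fin.tail_cons] at h2
    rw [← h2, ← sum_comp_perm i.cycleRange.symm fun τ : Fin (n + 1) → V =>
      G τ (f (Fin.tail τ) / X.degT (Fin.tail τ))]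
    refine Finset.sum_congr rfl fun τ _ => ?_
    have h1 := faceTerm_eq hf τ i.cycleRange.symm
    rw [Fin.cycleRange_symm_zero] at h1
    rw [hG, h1]
  simp [this]

theorem innerW_bdryHom [Fintype V] {n : ℕ} {f : (Fin n → V) → ℝ} {g : (Fin (n + 1) → V) → ℝ}
    (hg : X.IsForm (n + 1) g) (hf : X.IsForm n f) :
    X.innerW (X.bdryHom n g) f = innerU g (X.cobdHom n f) := by
  have h1 : ∑ τ, g τ * X.cobdHom n f τ = ∑ τ, ∑ i, g τ * X.faceTerm f τ i := by
    refine Finset.sum_congr rfl fun τ _ => ?_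
    rw [← Finset.mul_sum]
    by_cases h : X.IsCellT τ
    · rw [show X.cobdHom n f τ = _ from if_pos h]
    · rw [hg.1 τ h, zero_mul, zero_mul]
  have h2 := sum_faceTerm hf (G := fun τ x => g τ * x) fun τ π x => by
    rw [hg.2]
    ring
  have h3 : ∑ σ, X.bdryHom n g σ * f σ / X.degT σ =
      ∑ σ : Fin n → V, ∑ v, g (Fin.cons v σ) * (f σ / X.degT σ) :=
    Finset.sum_congr rfl fun σ _ => by
      rw [bdryHom_apply_of_isForm hg, mul_div_assoc, Finset.sum_mul]
  rw [innerU, innerW, h1, h2, h3, Nat.factorial_succ]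
  push_cast
  field_simp

theorem card_filter_isCellT_cons [Fintype V] {n : ℕ} {σ : Fin n → V} (hσ : X.IsCellT σ) :
    (Finset.univ.filter fun v => X.IsCellT (Fin.cons v σ : Fin (n + 1) → V)).card =
      X.degT σ := by
  have hcard : (Finset.image σ Finset.univ).card = n := by
    rw [Finset.card_image_of_injective _ hσ.1, Finset.card_univ, Fintype.card_fin]
  rw [degT, degS, ← Set.ncard_coe_finset]
  refine Set.ncard_congr (fun v _ => insert v (Finset.image σ Finset.univ)) ?_ ?_ ?_
  · intro v hv
    have hv : X.IsCellT (Fin.cons v σ : Fin (n + 1) → V) := by simpa using hv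
    have hmem : v ∉ Finset.image σ Finset.univ := by
      simpa using (Fin.cons_injective_iff.1 hv.1).1
    exact ⟨image_cons v σ ▸ hv.2, Finset.card_insert_of_notMem hmem, Finset.subset_insert _ _⟩
  · intro v w hv _ h
    have hv : X.IsCellT (Fin.cons v σ : Fin (n + 1) → V) := by simpa using hv
    have hmem : v ∉ Finset.image σ Finset.univ := by
      simpa using (Fin.cons_injective_iff.1 hv.1).1
    exact (Finset.mem_insert.1 (h ▸ Finset.mem_insert_self v _)).resolve_right hmem
  · rintro t ⟨ht, htc, hts⟩
    obtain ⟨v, hv, rfl⟩ := Finset.exists_eq_insert_iff.2 ⟨hts, htc.symm⟩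
    refine ⟨v, ?_, rfl⟩
    simp only [Finset.coe_filter, Finset.mem_univ, true_and, Set.mem_ofPred_eq]
    exact ⟨Fin.cons_injective_iff.2 ⟨by simpa using hv, hσ.1⟩, (image_cons v σ).symm ▸ ht⟩

theorem degT_pos [Fintype V] {n : ℕ}
    (huni : ∀ s ∈ X.cells, ∃ t ∈ X.cells, t.card = n + 1 ∧ s ⊆ t)
    {σ : Fin n → V} (hσ : X.IsCellT σ) : 0 < X.degT σ := by
  obtain ⟨t, ht, htc, hts⟩ := huni _ hσ.2
  refine (Set.ncard_pos (Set.toFinite _)).2 ⟨t, ht, ?_, hts⟩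
  rw [htc, Finset.card_image_of_injective _ hσ.1, Finset.card_univ, Fintype.card_fin]

theorem cobdHom_cons {n : ℕ} (f : (Fin (n + 1) → V) → ℝ) {v : V} {σ : Fin (n + 1) → V}
    (h : X.IsCellT (Fin.cons v σ : Fin (n + 2) → V)) :
    X.cobdHom (n + 1) f (Fin.cons v σ) = f σ / X.degT σ -
      ∑ i : Fin (n + 1), (-1 : ℝ) ^ (i : ℕ) * f (Fin.cons v (σ ∘ i.succAbove)) /
        (X.degT (Fin.cons v (σ ∘ i.succAbove) : Fin (n + 1) → V) : ℝ) := by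
  have hsucc : ∀ j : Fin (n + 1), (Fin.cons v σ : Fin (n + 2) → V) ∘ j.succ.succAbove =
      Fin.cons v (σ ∘ j.succAbove) := fun j => by
    funext k
    refine Fin.cases ?_ (fun k => ?_) k <;> simp
  have hzero : (Fin.cons v σ : Fin (n + 2) → V) ∘ (0 : Fin (n + 2)).succAbove = σ := by
    funext k
    simp
  change (if _ then _ else _) = _
  rw [if_pos h, Fin.sum_univ_succ, sub_eq_add_neg, ← Finset.sum_neg_distrib]
  congr 1
  · rw [faceTerm, hzero]
    simp
  · refine Finset.sum_congr rfl fun j _ => ?_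
    rw [faceTerm, hsucc, Fin.val_succ]
    ring

/-- The upper Laplacian is the boundary of the coboundary. -/
theorem bdryHom_cobdHom [Fintype V] {n : ℕ}
    (huni : ∀ s ∈ X.cells, ∃ t ∈ X.cells, t.card = n + 2 ∧ s ⊆ t)
    {f : (Fin (n + 1) → V) → ℝ} (hf : X.IsForm (n + 1) f) :
    X.bdryHom (n + 1) (X.cobdHom (n + 1) f) = X.lapUp f := by
  funext σ
  have hset : {v : V | X.IsCellT (Fin.cons v σ : Fin (n + 2) → V)} =
      ↑(Finset.univ.filter fun v => X.IsCellT (Fin.cons v σ : Fin (n + 2) → V)) := by simp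
  have hsum : X.bdryHom (n + 1) (X.cobdHom (n + 1) f) σ =
      ((Finset.univ.filter fun v => X.IsCellT (Fin.cons v σ : Fin (n + 2) → V)).card : ℝ) *
        (f σ / X.degT σ) - X.nbrW f σ := by
    rw [nbrW, hset, finsum_mem_coe_finset, ← nsmul_eq_mul, ← Finset.sum_const,
      ← Finset.sum_sub_distrib]
    exact Finset.sum_congr rfl fun v hv => cobdHom_cons f (Finset.mem_filter.1 hv).2
  rw [hsum, lapUp]
  by_cases hσ : X.IsCellT σ
  · have := degT_pos huni hσ
    rw [card_filter_isCellT_cons hσ]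
    field_simp
  · simp [hf.1 σ hσ]

theorem innerU_cobdHom_le [Fintype V] {n : ℕ} {f : (Fin n → V) → ℝ} (hf : X.IsForm n f) :
    innerU (X.cobdHom n f) (X.cobdHom n f) ≤ (n + 1) * X.innerW f f := by
  have h1 : ∑ τ, X.cobdHom n f τ * X.cobdHom n f τ ≤
      (n + 1) * ∑ τ, ∑ i, (if X.IsCellT τ then X.faceTerm f τ i ^ 2 else 0) := by
    rw [Finset.mul_sum]
    refine Finset.sum_le_sum fun τ _ => ?_
    change (if _ then _ else _) * (if _ then _ else _) ≤ _
    split_ifs with h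
    · have := sq_sum_le_card_mul_sum_sq (s := Finset.univ) (f := X.faceTerm f τ)
      rw [Finset.card_univ, Fintype.card_fin] at this
      rw [← sq]
      exact_mod_cast this
    · simp
  have h2 := sum_faceTerm hf (G := fun τ x => if X.IsCellT τ then x ^ 2 else 0) fun τ π x => by
    simp only [isCellT_comp_perm]
    rw [mul_pow, sq ((_ : ℤ) : ℝ), sign_mul_self, one_mul]
  have h3 : ∑ σ : Fin n → V, ∑ v : V, (if X.IsCellT (Fin.cons v σ : Fin (n + 1) → V) then
      (f σ / X.degT σ) ^ 2 else 0) = ∑ σ, f σ * f σ / X.degT σ := by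
    refine Finset.sum_congr rfl fun σ _ => ?_
    by_cases hσ : X.IsCellT σ
    · rw [← Finset.sum_filter, Finset.sum_const, card_filter_isCellT_cons hσ, nsmul_eq_mul]
      rcases eq_or_ne (X.degT σ : ℝ) 0 with h0 | h0
      · simp [h0]
      · field_simp
    · simp [hf.1 σ hσ]
  rw [h2, h3] at h1
  rw [innerU, innerW, Nat.factorial_succ]
  push_cast
  calc _ ≤ 1 / (((n : ℝ) + 1) * n.factorial) *
        ((n + 1) * ((n + 1) * ∑ σ, f σ * f σ / X.degT σ)) := by gcongr
    _ = _ := by field_simp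

theorem dirac_comp_perm {n : ℕ} {σ₀ : Fin n → V} (hσ₀ : Function.Injective σ₀)
    (π : Equiv.Perm (Fin n)) : dirac σ₀ (σ₀ ∘ π) = ((Equiv.Perm.sign π : ℤ) : ℝ) := by
  have huniq : ∀ ρ : Equiv.Perm (Fin n), σ₀ ∘ π = σ₀ ∘ ρ ↔ ρ = π := fun ρ => by
    rw [hσ₀.comp_left.eq_iff, eq_comm, DFunLike.coe_fn_eq]
  simp only [dirac, huniq, exists_eq_right]
  rcases Int.units_eq_one_or (Equiv.Perm.sign π) with h | h <;> simp [h]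

theorem dirac_eq_zero {n : ℕ} {σ₀ σ : Fin n → V}
    (h : ¬ ∃ π : Equiv.Perm (Fin n), σ = σ₀ ∘ π) : dirac σ₀ σ = 0 := by
  rw [dirac, if_neg fun ⟨π, _, hπ⟩ => h ⟨π, hπ⟩, if_neg fun ⟨π, _, hπ⟩ => h ⟨π, hπ⟩]

theorem isForm_dirac {n : ℕ} {σ₀ : Fin n → V} (hσ₀ : X.IsCellT σ₀) :
    X.IsForm n (dirac σ₀) := by
  refine ⟨fun σ hσ => dirac_eq_zero ?_, fun σ π => ?_⟩
  · rintro ⟨π, rfl⟩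
    exact hσ ((isCellT_comp_perm π).2 hσ₀)
  · by_cases h : ∃ ρ : Equiv.Perm (Fin n), σ = σ₀ ∘ ρ
    · obtain ⟨ρ, rfl⟩ := h
      rw [dirac_comp_perm hσ₀.1, Function.comp_assoc, ← Equiv.Perm.coe_mul,
        dirac_comp_perm hσ₀.1, Equiv.Perm.sign_mul]
      push_cast
      ring
    · rw [dirac_eq_zero h, dirac_eq_zero, mul_zero]
      rintro ⟨ρ, hρ⟩
      refine h ⟨ρ * π⁻¹, ?_⟩
      rw [Equiv.Perm.coe_mul, ← Function.comp_assoc, ← hρ, Function.comp_assoc,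
        ← Equiv.Perm.coe_mul]
      simp

theorem innerW_dirac_eq_zero_iff [Fintype V] {n : ℕ} {σ₀ : Fin n → V} (hσ₀ : X.IsCellT σ₀)
    (hdeg : 0 < X.degT σ₀) {h : (Fin n → V) → ℝ} (hh : X.IsForm n h) :
    X.innerW (dirac σ₀) h = 0 ↔ h σ₀ = 0 := by
  have hterm : ∀ σ, dirac σ₀ σ * h σ / (X.degT σ : ℝ) =
      if ∃ π : Equiv.Perm (Fin n), σ = σ₀ ∘ π then h σ₀ / X.degT σ₀ else 0 := fun σ => by
    split_ifs with hσ
    · obtain ⟨π, rfl⟩ := hσ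
      rw [dirac_comp_perm hσ₀.1, hh.2, degT_comp_perm, ← mul_assoc, sign_mul_self, one_mul]
    · rw [dirac_eq_zero hσ, zero_mul, zero_div]
  have hne : (Finset.univ.filter
      fun σ : Fin n → V => ∃ π : Equiv.Perm (Fin n), σ = σ₀ ∘ π).card ≠ 0 :=
    Finset.card_ne_zero_of_mem (a := σ₀) (by simpa using ⟨1, rfl⟩)
  simp only [innerW, hterm, ← Finset.sum_filter, Finset.sum_const]
  simp [Nat.factorial_ne_zero, hne, hdeg.ne']

/-- The weighted inner product as a bilinear form. -/
def innerB [Fintype V] (X : SComplex V) (n : ℕ) : LinearMap.BilinForm ℝ ((Fin n → V) → ℝ) :=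
  LinearMap.mk₂ ℝ X.innerW
    (fun f f' g => by
      simp only [innerW, Pi.add_apply, add_mul, add_div, Finset.sum_add_distrib, mul_add])
    (fun c f g => by
      simp only [innerW, Pi.smul_apply, smul_eq_mul, Finset.mul_sum]
      exact Finset.sum_congr rfl fun _ _ => by ring)
    (fun f g g' => by
      simp only [innerW, Pi.add_apply, mul_add, add_div, Finset.sum_add_distrib])
    (fun c f g => by
      simp only [innerW, Pi.smul_apply, smul_eq_mul, Finset.mul_sum]
      exact Finset.sum_congr rfl fun _ _ => by ring)

theorem innerW_comm [Fintype V] {n : ℕ} (f g : (Fin n → V) → ℝ) :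
    X.innerW f g = X.innerW g f := by
  simp only [innerW, mul_comm]

theorem innerU_comm [Fintype V] {n : ℕ} (f g : (Fin n → V) → ℝ) :
    innerU f g = innerU g f := by
  simp only [innerU, mul_comm]

theorem innerU_self_nonneg [Fintype V] {n : ℕ} (f : (Fin n → V) → ℝ) : 0 ≤ innerU f f :=
  mul_nonneg (by positivity) (Finset.sum_nonneg fun σ _ => mul_self_nonneg (f σ))

theorem innerU_self_eq_zero [Fintype V] {n : ℕ} {f : (Fin n → V) → ℝ} (h : innerU f f = 0) :
    f = 0 := by
  rw [innerU, mul_eq_zero, Finset.sum_eq_zero_iff_of_nonneg fun σ _ => mul_self_nonneg _] at h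
  funext σ
  simpa using h.resolve_left (by positivity) σ (Finset.mem_univ σ)

theorem innerW_self_pos [Fintype V] {n : ℕ}
    (huni : ∀ s ∈ X.cells, ∃ t ∈ X.cells, t.card = n + 1 ∧ s ⊆ t)
    {f : (Fin n → V) → ℝ} (hf : X.IsForm n f) (h0 : f ≠ 0) : 0 < X.innerW f f := by
  refine mul_pos (by positivity) (Finset.sum_pos' (fun σ _ => ?_) ?_)
  · exact div_nonneg (mul_self_nonneg _) (Nat.cast_nonneg _)
  · obtain ⟨σ, hσ⟩ := Function.ne_iff.1 h0
    have hcell : X.IsCellT σ := by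
      by_contra h
      exact hσ (hf.1 σ h)
    exact ⟨σ, Finset.mem_univ σ, div_pos (mul_self_pos.2 hσ)
      (Nat.cast_pos.2 (degT_pos huni hcell))⟩

/-- The upper Laplacian on forms. -/
def lapHom [Fintype V] (X : SComplex V) (n : ℕ) :
    X.formSubmodule (n + 1) →ₗ[ℝ] X.formSubmodule (n + 1) :=
  (X.bdryHom (n + 1) ∘ₗ X.cobdHom (n + 1)).restrict fun _ hf =>
    isForm_bdryHom (isForm_cobdHom hf)

theorem innerW_lapHom [Fintype V] {n : ℕ} (f g : X.formSubmodule (n + 1)) :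
    X.innerW (X.lapHom n f : (Fin (n + 1) → V) → ℝ) g =
      innerU (X.cobdHom (n + 1) f) (X.cobdHom (n + 1) g) :=
  innerW_bdryHom (isForm_cobdHom f.2) g.2

theorem lapHom_eq_zero_iff [Fintype V] {n : ℕ} {f : X.formSubmodule (n + 1)} :
    X.lapHom n f = 0 ↔
      ∀ g, X.IsForm (n + 2) g → X.innerW (X.bdryHom (n + 1) g) (f : (Fin (n + 1) → V) → ℝ) = 0 := by
  constructor
  · intro h g hg
    have hf : X.cobdHom (n + 1) f = 0 := by
      apply innerU_self_eq_zero
      rw [← innerW_lapHom, h]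
      simp [innerW]
    rw [innerW_bdryHom hg f.2, hf]
    simp [innerU]
  · intro h
    have hf : X.cobdHom (n + 1) f = 0 := by
      apply innerU_self_eq_zero
      rw [← innerW_lapHom]
      exact h _ (isForm_cobdHom f.2)
    apply Subtype.ext
    change X.bdryHom (n + 1) (X.cobdHom (n + 1) f) = 0
    rw [hf, map_zero]

theorem nexp_eq [Fintype V] {n : ℕ}
    (huni : ∀ s ∈ X.cells, ∃ t ∈ X.cells, t.card = n + 2 ∧ s ⊆ t)
    {p : ℝ} (hp : 0 < p * n + 1) {σ₀ : Fin (n + 1) → V} (hσ₀ : X.IsCellT σ₀) (k : ℕ) :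
    X.nexp p σ₀ k = (((1 - ((1 - p) / (p * n + 1)) • X.lapHom n) ^ k)
      ⟨dirac σ₀, isForm_dirac hσ₀⟩ : X.formSubmodule (n + 1)) := by
  set M := 1 - ((1 - p) / (p * n + 1)) • X.lapHom n with hM
  have hn : (0 : ℝ) < n + 1 := by positivity
  have hsmul : ∀ (c : ℝ) (f : X.formSubmodule (n + 1)),
      X.transOp p (c • (f : (Fin (n + 1) → V) → ℝ)) =
        (c * ((p * n + 1) / (n + 1))) • (M f : (Fin (n + 1) → V) → ℝ) := fun c f => by
    have hform : X.IsForm (n + 1) (c • (f : (Fin (n + 1) → V) → ℝ)) := (c • f).2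
    have hlap : X.lapUp (c • (f : (Fin (n + 1) → V) → ℝ)) =
        c • (X.lapHom n f : (Fin (n + 1) → V) → ℝ) := by
      rw [← bdryHom_cobdHom huni hform, map_smul, map_smul]
      rfl
    funext σ
    have h := congrFun hlap σ
    simp only [lapUp, Pi.smul_apply, smul_eq_mul] at h
    simp only [transOp, hM, Pi.smul_apply, smul_eq_mul, LinearMap.sub_apply, Module.End.one_apply,
      LinearMap.smul_apply, Submodule.coe_sub, Submodule.coe_smul, Pi.sub_apply]
    rw [sub_eq_iff_eq_add, ← sub_eq_iff_eq_add'] at h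
    rw [← h]
    field_simp
    ring
  have hiter : ∀ k : ℕ, (X.transOp p)^[k] (dirac σ₀) = (((p * n + 1) / (n + 1) : ℝ) ^ k) •
      (((M ^ k) ⟨dirac σ₀, isForm_dirac hσ₀⟩ : X.formSubmodule (n + 1)) :
        (Fin (n + 1) → V) → ℝ) := fun k => by
    induction k with
    | zero => simp
    | succ k ih =>
      rw [Function.iterate_succ_apply', ih, hsmul, pow_succ, pow_succ' M]
      rfl
  rw [nexp, hiter, smul_smul, ← mul_pow, div_mul_div_comm, mul_comm, div_self (by positivity),
    one_pow, one_smul]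

/-- The normalized expectation process converges to the orthogonal projection of the Dirac form
onto the closed forms. -/
theorem exists_tendsto_nexp [Fintype V] {n : ℕ}
    (huni : ∀ s ∈ X.cells, ∃ t ∈ X.cells, t.card = n + 2 ∧ s ⊆ t)
    {p : ℝ} (hp₁ : (n : ℝ) / (3 * n + 2) < p) (hp₂ : p < 1)
    {σ₀ : Fin (n + 1) → V} (hσ₀ : X.IsCellT σ₀) :
    ∃ L, X.IsForm (n + 1) L ∧
      (∀ g, X.IsForm (n + 2) g → X.innerW (X.bdryHom (n + 1) g) L = 0) ∧
      (∀ h, X.IsForm (n + 1) h →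
        (∀ g, X.IsForm (n + 2) g → X.innerW (X.bdryHom (n + 1) g) h = 0) →
          X.innerW L h = X.innerW (dirac σ₀) h) ∧
      Tendsto (fun k => X.nexp p σ₀ k) atTop (𝓝 L) := by
  have hn : (0 : ℝ) ≤ n := Nat.cast_nonneg n
  have hp0 : 0 < p := lt_of_le_of_lt (by positivity) hp₁
  have hden : 0 < p * n + 1 := by positivity
  rw [div_lt_iff₀ (by positivity)] at hp₁
  obtain ⟨L, hL, hLh, hlim⟩ := exists_tendsto_iterate_one_sub (X.formSubmodule (n + 1)).subtype
    ((X.innerB (n + 1)).restrict (X.formSubmodule (n + 1))) (fun f g => innerW_comm _ _)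
    (fun f hf => innerW_self_pos huni f.2 (by simpa using hf)) (X.lapHom n)
    (fun f g => (innerW_lapHom f g).trans
      ((innerU_comm _ _).trans ((innerW_lapHom g f).symm.trans (innerW_comm _ _))))
    (K := ((n + 1 : ℕ) : ℝ) + 1) (a := (1 - p) / (p * n + 1))
    (fun f => (innerU_self_nonneg _).trans_eq (innerW_lapHom f f).symm)
    (fun f => (innerW_lapHom f f).trans_le (innerU_cobdHom_le f.2))
    (div_pos (by linarith) hden)
    (by
      rw [div_mul_eq_mul_div, div_lt_iff₀ hden]
      push_cast
      linarith)
    ⟨dirac σ₀, isForm_dirac hσ₀⟩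
  refine ⟨L, L.2, lapHom_eq_zero_iff.1 hL, fun h hh hg => ?_, ?_⟩
  · exact hLh ⟨h, hh⟩ (lapHom_eq_zero_iff.2 hg)
  · simp only [nexp_eq huni hden hσ₀]
    exact hlim

end SComplex

/-- For a finite uniform `d`-dimensional complex (`d = m+2 ≥ 2`) and
`(d-1)/(3d-1) < p < 1`, the limits `Ẽ_∞^σ` of the normalized expectation processes
exist, and the dimension of `H_{d-1}(X;ℝ) = ker ∂_{d-1} / im ∂_d` equals the dimension
of the span of the orthogonal projections of the `Ẽ_∞^σ` onto `Z_{d-1} = ker ∂_{d-1}`. -/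
theorem stmt2 {V : Type*} [Fintype V] (m : ℕ) (X : SComplex V)
    (hdim : ∀ s ∈ X.cells, s.card ≤ m + 3)
    (huni : ∀ s ∈ X.cells, ∃ t ∈ X.cells, t.card = m + 3 ∧ s ⊆ t)
    (htop : ∃ s ∈ X.cells, s.card = m + 3)
    (p : ℝ) (hp₁ : ((m + 2 : ℝ) - 1) / (3 * (m + 2 : ℝ) - 1) < p) (hp₂ : p < 1) :
    (∀ σ₀ : Fin (m + 2) → V, X.IsCellT σ₀ →
        ∃ L, Tendsto (fun nn => X.nexp p σ₀ nn) atTop (𝓝 L)) ∧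
      ∀ P : ((Fin (m + 2) → V) → ℝ) → ((Fin (m + 2) → V) → ℝ),
        (∀ f, X.IsForm (m + 2) f →
          X.IsForm (m + 2) (P f) ∧ X.bdryHom (m + 1) (P f) = 0 ∧
            ∀ z, X.IsForm (m + 2) z → X.bdryHom (m + 1) z = 0 →
              X.innerW (f - P f) z = 0) →
        ∀ E : (Fin (m + 2) → V) → ((Fin (m + 2) → V) → ℝ),
          (∀ σ₀, X.IsCellT σ₀ → Tendsto (fun nn => X.nexp p σ₀ nn) atTop (𝓝 (E σ₀))) →
          Module.finrank ℝ
              (↥(X.formSubmodule (m + 2) ⊓ LinearMap.ker (X.bdryHom (m + 1))) ⧸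
                Submodule.comap
                  (X.formSubmodule (m + 2) ⊓ LinearMap.ker (X.bdryHom (m + 1))).subtype
                  (Submodule.map (X.bdryHom (m + 2)) (X.formSubmodule (m + 3)))) =
            Module.finrank ℝ
              (Submodule.span ℝ
                {g : (Fin (m + 2) → V) → ℝ |
                  ∃ σ₀ : Fin (m + 2) → V, X.IsCellT σ₀ ∧ g = P (E σ₀)}) := by
  have hp : ((m + 1 : ℕ) : ℝ) / (3 * ((m + 1 : ℕ) : ℝ) + 2) < p := by
    convert hp₁ using 2 <;> push_cast <;> ring
  refine ⟨fun σ₀ hσ₀ => ?_, fun P hP E hE => ?_⟩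
  · obtain ⟨L, -, -, -, hL⟩ := exists_tendsto_nexp huni hp hp₂ hσ₀
    exact ⟨L, hL⟩
  have hElim : ∀ σ₀, X.IsCellT σ₀ → X.IsForm (m + 2) (E σ₀) ∧
      (∀ g, X.IsForm (m + 3) g → X.innerW (X.bdryHom (m + 2) g) (E σ₀) = 0) ∧
      ∀ h, X.IsForm (m + 2) h →
        (∀ g, X.IsForm (m + 3) g → X.innerW (X.bdryHom (m + 2) g) h = 0) →
          X.innerW (E σ₀) h = X.innerW (dirac σ₀) h := fun σ₀ hσ₀ => by
    obtain ⟨L, hL, hLB, hLh, hlim⟩ := exists_tendsto_nexp huni hp hp₂ hσ₀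
    rw [tendsto_nhds_unique (hE σ₀ hσ₀) hlim]
    exact ⟨hL, hLB, hLh⟩
  set Z := X.formSubmodule (m + 2) ⊓ LinearMap.ker (X.bdryHom (m + 1))
  set U := Submodule.map (X.bdryHom (m + 2)) (X.formSubmodule (m + 3))
  set S := Submodule.span ℝ {g : (Fin (m + 2) → V) → ℝ |
    ∃ σ₀ : Fin (m + 2) → V, X.IsCellT σ₀ ∧ g = P (E σ₀)} with hSdef
  have hPE : ∀ σ₀, X.IsCellT σ₀ → ∀ z ∈ Z, X.innerW (P (E σ₀)) z = X.innerW (E σ₀) z :=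
    fun σ₀ hσ₀ z hz => by
      have h1 := (hP _ (hElim σ₀ hσ₀).1).2.2 z hz.1 hz.2
      have h2 := LinearMap.map_sub₂ (X.innerB (m + 2)) (E σ₀) (P (E σ₀)) z
      exact (sub_eq_zero.1 (h2.symm.trans h1)).symm
  have hU : U ≤ Z := by
    rintro _ ⟨g, hg, rfl⟩
    exact ⟨isForm_bdryHom hg, bdryHom_bdryHom hg⟩
  have hS : S ≤ Z := by
    rw [hSdef, Submodule.span_le]
    rintro _ ⟨σ₀, hσ₀, rfl⟩
    have h := hP _ (hElim σ₀ hσ₀).1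
    exact ⟨h.1, h.2.1⟩
  have horth : ∀ x ∈ U, ∀ y ∈ S, X.innerB (m + 2) x y = 0 := by
    intro x hx y hy
    have hle : S ≤ LinearMap.ker (X.innerB (m + 2) x) := by
      rw [hSdef, Submodule.span_le]
      rintro _ ⟨σ₀, hσ₀, rfl⟩
      obtain ⟨g, hg, rfl⟩ := hx
      change X.innerW _ _ = 0
      rw [innerW_comm, hPE σ₀ hσ₀ _ (hU ⟨g, hg, rfl⟩), innerW_comm]
      exact (hElim σ₀ hσ₀).2.1 g hg
    exact hle hy
  have hcompl : ∀ z ∈ Z, (∀ x ∈ U, X.innerB (m + 2) x z = 0) →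
      (∀ y ∈ S, X.innerB (m + 2) y z = 0) → z = 0 := by
    intro z hz hzU hzS
    funext σ₀
    by_cases hσ₀ : X.IsCellT σ₀
    · rw [Pi.zero_apply, ← innerW_dirac_eq_zero_iff hσ₀ (degT_pos huni hσ₀) hz.1,
        ← (hElim σ₀ hσ₀).2.2 z hz.1 fun g hg => hzU _ ⟨g, hg, rfl⟩, ← hPE σ₀ hσ₀ z hz]
      exact hzS _ (Submodule.subset_span ⟨σ₀, hσ₀, rfl⟩)
    · exact hz.1.1 σ₀ hσ₀
  have h1 := finrank_add_finrank_of_orthogonal _ (fun f g => innerW_comm f g) hU hS horth hcompl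
  have h2 := Submodule.finrank_quotient_add_finrank (Submodule.comap Z.subtype U)
  rw [(Submodule.comapSubtypeEquivOfLe hU).finrank_eq] at h2
  omega

end
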